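/- Let d > r ≥ 1 be integers and λ₁, λ₂ real numbers. The quadratic form q_{λ₁,λ₂} on ℝ^d is negative definite if and only if λ₁ < 0 and λ₂ < λ₁(r−1)/(2(r+1)). -/

import Mathlib

noncomputable section

/-- The quadratic form `q_{λ₁,λ₂}` on `ℝ^d` (coordinates `u_1,…,u_{d−r}, x_1,…,x_r`):
`q = λ₁·Σ u_j² + λ₂·Σ x_i² + (λ₂ − λ₁/2)·Σ_{i<j} x_i x_j`. -/
def qform (d r : ℕ) (l1 l2 : ℝ) (v : Fin (d - r) ⊕ Fin r → ℝ) : ℝ :=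
  l1 * ∑ j : Fin (d - r), v (Sum.inl j) ^ 2 + l2 * ∑ i : Fin r, v (Sum.inr i) ^ 2 +
    (l2 - l1 / 2) * ∑ i : Fin r, ∑ j ∈ Finset.Ioi i, v (Sum.inr i) * v (Sum.inr j)

/-- The sum of the mixed products `x i * x j`, `i < j`, through power sums. -/
theorem two_mul_sum_sum_Ioi_mul (n : ℕ) (x : Fin n → ℝ) :
    2 * ∑ i : Fin n, ∑ j ∈ Finset.Ioi i, x i * x j = (∑ i, x i) ^ 2 - ∑ i, x i ^ 2 := by
  induction n with
  | zero => simp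
  | succ n ih =>
    have h := ih fun i => x i.succ
    simp only [Fin.sum_univ_succ, Fin.sum_Ioi_zero, Fin.sum_Ioi_succ, ← Finset.mul_sum] at h ⊢
    linear_combination h

/-- `qform` in terms of the power sums of the coordinates. -/
theorem qform_eq (d r : ℕ) (l1 l2 : ℝ) (v : Fin (d - r) ⊕ Fin r → ℝ) :
    qform d r l1 l2 v = l1 * ∑ j : Fin (d - r), v (Sum.inl j) ^ 2 +
      ((l2 / 2 + l1 / 4) * ∑ i : Fin r, v (Sum.inr i) ^ 2 +
        (l2 - l1 / 2) / 2 * (∑ i : Fin r, v (Sum.inr i)) ^ 2) := by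
  have h := two_mul_sum_sum_Ioi_mul r fun i => v (Sum.inr i)
  unfold qform
  linear_combination (l2 - l1 / 2) / 2 * h

/-- `q_{λ₁,λ₂}` is negative definite iff `λ₁ < 0` and `λ₂ < λ₁(r−1)/(2(r+1))`. -/
theorem stmt13 (d r : ℕ) (hr : 1 ≤ r) (hrd : r < d) (l1 l2 : ℝ) :
    (∀ v : Fin (d - r) ⊕ Fin r → ℝ, v ≠ 0 → qform d r l1 l2 v < 0) ↔
      (l1 < 0 ∧ l2 < l1 * ((r : ℝ) - 1) / (2 * ((r : ℝ) + 1))) := by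
  have hr' : (1 : ℝ) ≤ r := by exact_mod_cast hr
  have hd : (0 : ℝ) < (d - r : ℕ) := by exact_mod_cast Nat.sub_pos_of_lt hrd
  rw [lt_div_iff₀ (by positivity)]
  constructor
  · intro h
    constructor
    · have h1 := h (Sum.elim (fun _ => 1) fun _ => 0) fun h0 => by
        simpa using congrFun h0 (Sum.inl ⟨0, Nat.sub_pos_of_lt hrd⟩)
      rw [qform_eq] at h1
      simp only [Sum.elim_inl, Sum.elim_inr, one_pow, Finset.sum_const, Finset.card_univ,
        Fintype.card_fin, nsmul_eq_mul] at h1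
      nlinarith
    · have h1 := h (Sum.elim (fun _ => 0) fun _ => 1) fun h0 => by
        simpa using congrFun h0 (Sum.inr ⟨0, hr⟩)
      rw [qform_eq] at h1
      simp only [Sum.elim_inl, Sum.elim_inr, one_pow, Finset.sum_const, Finset.card_univ,
        Fintype.card_fin, nsmul_eq_mul] at h1
      nlinarith
  · rintro ⟨h1, h2⟩ v hv
    rw [qform_eq]
    set U := ∑ j : Fin (d - r), v (Sum.inl j) ^ 2
    set X := ∑ i : Fin r, v (Sum.inr i) ^ 2
    have hU0 : 0 ≤ U := Finset.sum_nonneg fun _ _ => sq_nonneg _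
    have hX0 : 0 ≤ X := Finset.sum_nonneg fun _ _ => sq_nonneg _
    have hCS : (∑ i : Fin r, v (Sum.inr i)) ^ 2 ≤ r * X := by
      simpa using sq_sum_le_card_mul_sum_sq (s := Finset.univ) (f := fun i => v (Sum.inr i))
    have hpos : 0 < U ∨ 0 < X := by
      by_contra! hc
      apply hv
      have hUz := (Finset.sum_eq_zero_iff_of_nonneg fun _ _ => sq_nonneg _).1
        (le_antisymm hc.1 hU0)
      have hXz := (Finset.sum_eq_zero_iff_of_nonneg fun _ _ => sq_nonneg _).1
        (le_antisymm hc.2 hX0)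
      ext (j | i)
      · simpa using hUz j (Finset.mem_univ _)
      · simpa using hXz i (Finset.mem_univ _)
    obtain ⟨m, hm, hle⟩ : ∃ m < 0, (l2 / 2 + l1 / 4) * X +
        (l2 - l1 / 2) / 2 * (∑ i : Fin r, v (Sum.inr i)) ^ 2 ≤ m * X := by
      rcases le_total (l2 - l1 / 2) 0 with hc | hc
      · refine ⟨l2 / 2 + l1 / 4, ?_, ?_⟩
        · nlinarith
        · nlinarith [sq_nonneg (∑ i : Fin r, v (Sum.inr i))]
      · refine ⟨l2 / 2 + l1 / 4 + (l2 - l1 / 2) / 2 * r, by linarith, ?_⟩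
        nlinarith
    rcases hpos with hp | hp <;> nlinarith
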